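/- The family 𝒮 = (S_{x,L})_{x∈E, L≥1 integer} of separation events is a family of increasing events on {0,1}^E that cascades with complexity at most α + β/2. -/

import Mathlib

open MeasureTheory Filter Set
open scoped ENNReal NNReal Topology Classical

noncomputable section

/-- The weighted graph `G`: an infinite connected graph of bounded degree, with a weight
`ρG` which is uniformly bounded and uniformly positive on edges, `α`-Ahlfors regular. -/
structure GraphSetup where
  V : Type
  infV : Infinite V
  adjG : V → V → Prop
  adjG_symm : ∀ {y y'}, adjG y y' → adjG y' y
  adjG_irrefl : ∀ y, ¬adjG y y
  /-- `dG` is the graph distance on `G`; this characterization also encodes connectedness. -/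
  dG : V → V → ℕ
  dG_spec : ∀ (y y' : V) (n : ℕ), dG y y' ≤ n ↔
    ∃ p : ℕ → V, p 0 = y ∧ p n = y' ∧ ∀ i < n, p i = p (i + 1) ∨ adjG (p i) (p (i + 1))
  ballG_fin : ∀ (y : V) (R : ℝ), {y' | (dG y y' : ℝ) ≤ R}.Finite
  degBound : ℕ
  deg_fin : ∀ y : V, {y' | adjG y y'}.Finite
  deg_le : ∀ y : V, Nat.card {y' // adjG y y'} ≤ degBound
  ρG : V → V → ℝ
  ρG_symm : ∀ y y', ρG y y' = ρG y' y
  ρG_nonneg : ∀ y y', 0 ≤ ρG y y'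
  ρG_pos_iff : ∀ y y', 0 < ρG y y' ↔ adjG y y'
  ρG_lbd : ℝ
  ρG_ubd : ℝ
  ρG_lbd_pos : 0 < ρG_lbd
  ρG_bounds : ∀ y y', adjG y y' → ρG_lbd ≤ ρG y y' ∧ ρG y y' ≤ ρG_ubd
  α : ℝ
  β : ℝ
  α_gt_one : 1 < α
  β_ge_two : 2 ≤ β
  β_le_α_add_one : β ≤ α + 1
  cA : ℝ
  cA' : ℝ
  cA_pos : 0 < cA
  /-- `α`-Ahlfors regularity of `(G, ρG)`, lower bound. -/
  ahlfors_lb : ∀ (y : V) (R : ℝ), 1 / 2 ≤ R →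
    cA * R ^ α ≤ ∑ y' ∈ (ballG_fin y R).toFinset, ∑' y'', ρG y' y''
  /-- `α`-Ahlfors regularity of `(G, ρG)`, upper bound. -/
  ahlfors_ub : ∀ (y : V) (R : ℝ), 1 / 2 ≤ R →
    (∑ y' ∈ (ballG_fin y R).toFinset, ∑' y'', ρG y' y'') ≤ cA' * R ^ α

namespace GraphSetup

/-- The product graph `E = G × ℤ`. -/
abbrev E (S : GraphSetup) : Type := S.V × ℤ

instance (S : GraphSetup) : MeasurableSpace S.V := ⊤

/-- The exponent `ν = α - β/2`. -/
def ν (S : GraphSetup) : ℝ := S.α - S.β / 2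

/-- Adjacency on `E = G × ℤ`. -/
def adjE (S : GraphSetup) (x x' : S.E) : Prop :=
  (x.2 = x'.2 ∧ S.adjG x.1 x'.1) ∨ (x.1 = x'.1 ∧ (x.2 - x'.2).natAbs = 1)

/-- The weight on `E`: `ρG` on horizontal edges, `1` on vertical edges. -/
def ρE (S : GraphSetup) (x x' : S.E) : ℝ :=
  if x.2 = x'.2 then S.ρG x.1 x'.1
  else if x.1 = x'.1 ∧ (x.2 - x'.2).natAbs = 1 then 1 else 0

/-- `ρ(x) = Σ_{x' ~ x} ρ_{x,x'}`. -/
def ρEpt (S : GraphSetup) (x : S.E) : ℝ := ∑' x', S.ρE x x'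

/-- Transition probability of the walk on `E`. -/
def ptrans (S : GraphSetup) (x x' : S.E) : ℝ := S.ρE x x' / S.ρEpt x

/-- The metric `d((y,z),(y',z')) = max (d_G(y,y'), |z - z'|^{2/β})` on `E`. -/
def dE (S : GraphSetup) (x x' : S.E) : ℝ :=
  max (S.dG x.1 x'.1 : ℝ) (|(x.2 : ℝ) - (x'.2 : ℝ)| ^ (2 / S.β))

/-- Closed `d`-ball in `E`. -/
def ball (S : GraphSetup) (x : S.E) (r : ℝ) : Set S.E := {x' | S.dE x x' ≤ r}

/-- Vertex boundary `∂U`. -/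
def vBoundary (S : GraphSetup) (U : Set S.E) : Set S.E :=
  {x | x ∉ U ∧ ∃ x' ∈ U, S.adjE x x'}

/-- Closure `U ∪ ∂U`. -/
def cl (S : GraphSetup) (U : Set S.E) : Set S.E := U ∪ S.vBoundary U

/-- Interior vertex boundary `∂_int U`. -/
def intBoundary (S : GraphSetup) (U : Set S.E) : Set S.E :=
  {x | x ∈ U ∧ ∃ x', x' ∉ U ∧ S.adjE x x'}

/-- A nearest-neighbour path of length `n` contained in `A`. -/
def IsPathIn (S : GraphSetup) (A : Set S.E) (p : ℕ → S.E) (n : ℕ) : Prop :=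
  (∀ i ≤ n, p i ∈ A) ∧ ∀ i < n, S.adjE (p i) (p (i + 1))

/-- `B₁` is connected to `B₂` by a nearest-neighbour path contained in `A`. -/
def ConnectsIn (S : GraphSetup) (A B₁ B₂ : Set S.E) : Prop :=
  ∃ (n : ℕ) (p : ℕ → S.E), S.IsPathIn A p n ∧ p 0 ∈ B₁ ∧ p n ∈ B₂

/-- The connected component of `x` inside `A`. -/
def component (S : GraphSetup) (A : Set S.E) (x : S.E) : Set S.E :=
  {x' | S.ConnectsIn A {x} {x'}}

/-- `A` is a connected subset of `E`. -/
def IsConnectedSet (S : GraphSetup) (A : Set S.E) : Prop :=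
  ∀ x ∈ A, ∀ x' ∈ A, S.ConnectsIn A {x} {x'}

/-- `C` separates `A` and `B` in `U`: the graph distance between `A` and `B` exceeds `1`
and every nearest-neighbour path from `∂A` to `∂B` remaining in `U` meets `C`. -/
def Separates (S : GraphSetup) (A B C U : Set S.E) : Prop :=
  (∀ a ∈ A, ∀ b ∈ B, a ≠ b ∧ ¬S.adjE a b) ∧
  ∀ (n : ℕ) (p : ℕ → S.E), (∀ i ≤ n, p i ∈ U) → (∀ i < n, S.adjE (p i) (p (i + 1))) →
    p 0 ∈ S.vBoundary A → p n ∈ S.vBoundary B → ∃ i ≤ n, p i ∈ C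

/-- The separation event `S_{x,L}`. -/
def sepEvent (S : GraphSetup) (x : S.E) (L : ℕ) : Set (Set S.E) :=
  {C | ∃ A₁ A₂ : Set S.E,
    A₁ ⊆ S.cl (S.ball x (3 * L)) ∧ A₂ ⊆ S.cl (S.ball x (3 * L)) ∧
    S.IsConnectedSet A₁ ∧ S.IsConnectedSet A₂ ∧
    (∃ a ∈ A₁, ∃ a' ∈ A₁, (L : ℝ) ≤ S.dE a a') ∧
    (∃ a ∈ A₂, ∃ a' ∈ A₂, (L : ℝ) ≤ S.dE a a') ∧
    S.Separates A₁ A₂ C (S.ball x (5 * L))}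

/-- A half-plane of `E = G × ℤ`: the product of a semi-infinite geodesic in `G` with `ℤ`. -/
structure HalfPlane (S : GraphSetup) where
  ray : ℕ → S.V
  geodesic : ∀ n m : ℕ, S.dG (ray n) (ray m) = Nat.dist n m

/-- The set of points of a half-plane. -/
def HalfPlane.carrier {S : GraphSetup} (P : S.HalfPlane) : Set S.E :=
  {x | ∃ n, x.1 = P.ray n}

/-- `B₁` is connected to `B₂` by a `*`-path contained in `A ∩ 𝒫`. -/
def StarConnectsIn (S : GraphSetup) (P : S.HalfPlane) (A B₁ B₂ : Set S.E) : Prop :=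
  ∃ (n : ℕ) (p : ℕ → S.E),
    (∀ i ≤ n, p i ∈ A ∧ p i ∈ P.carrier) ∧
    (∀ i < n, p i ≠ p (i + 1) ∧ S.dG (p i).1 (p (i + 1)).1 ≤ 1 ∧
      ((p i).2 - (p (i + 1)).2).natAbs ≤ 1) ∧
    p 0 ∈ B₁ ∧ p n ∈ B₂

/-- An increasing event on `{0,1}^E` (configurations identified with subsets of `E`). -/
def IncreasingEvent (S : GraphSetup) (A : Set (Set S.E)) : Prop :=
  ∀ C C' : Set S.E, C ⊆ C' → C ∈ A → C' ∈ A

/-- A decreasing event on `{0,1}^E`. -/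
def DecreasingEvent (S : GraphSetup) (A : Set (Set S.E)) : Prop :=
  ∀ C C' : Set S.E, C' ⊆ C → C ∈ A → C' ∈ A

/-- The event `A` only depends on the coordinates in `B`. -/
def DependsOn (S : GraphSetup) (A : Set (Set S.E)) (B : Set S.E) : Prop :=
  ∀ C C' : Set S.E, C ∩ B = C' ∩ B → (C ∈ A ↔ C' ∈ A)

/-- The family `(G_{x,L})` cascades with complexity at most `lam`, with constant `c`. -/
def CascadesLe (S : GraphSetup) (Gf : S.E → ℕ → Set (Set S.E)) (lam c : ℝ) : Prop :=
  (∀ (x : S.E) (L : ℕ), 1 ≤ L → S.DependsOn (Gf x L) (S.ball x (10 * L))) ∧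
  ∀ (ℓ : ℕ) (x : S.E) (L : ℕ), 1 ≤ L → 0 < ℓ → 100 ∣ ℓ →
    ∃ Λ : Finset S.E, ↑Λ ⊆ S.ball x (9 * ℓ * L) ∧ (Λ.card : ℝ) ≤ c * (ℓ : ℝ) ^ lam ∧
      Gf x (ℓ * L) ⊆
        ⋃ x' ∈ Λ, ⋃ x'' ∈ Λ,
          ⋃ (_ : ((ℓ * L : ℕ) : ℝ) / 100 ≤ S.dE x' x''), Gf x' L ∩ Gf x'' L

/-- The length scales `L_n = ℓ₀ⁿ L₀`. -/
def Lscale (ℓ₀ L₀ n : ℕ) : ℕ := ℓ₀ ^ n * L₀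

/-- Membership in `Λ_n`: an embedding of the dyadic tree of depth `n` in `E`,
with nested balls and spread-out children. -/
def IsTreeEmbed (S : GraphSetup) (ℓ₀ L₀ n : ℕ) (T : ∀ k : ℕ, (Fin k → Bool) → S.E) : Prop :=
  ∀ k < n, ∀ (m : Fin k → Bool) (b : Bool),
    S.ball (T (k + 1) (Fin.snoc m b)) (10 * Lscale ℓ₀ L₀ (n - (k + 1))) ⊆
        S.ball (T k m) (10 * Lscale ℓ₀ L₀ (n - k)) ∧
      ((Lscale ℓ₀ L₀ (n - k) : ℝ)) / 100 ≤
        S.dE (T (k + 1) (Fin.snoc m false)) (T (k + 1) (Fin.snoc m true))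

/-- The factor `1 + c₁ √K (k+1)^{-3/2} ℓ₀^{-(ν-ν')/2}`. -/
def decFactor (c₁ K νv ν' : ℝ) (ℓ₀ : ℕ) (k : ℕ) : ℝ :=
  1 + c₁ * Real.sqrt K * ((k : ℝ) + 1) ^ (-(3 : ℝ) / 2) * (ℓ₀ : ℝ) ^ (-(νv - ν') / 2)

/-- The increasing sequence of levels `u_n⁺`. -/
def uPlusSeq (c₁ K νv ν' : ℝ) (ℓ₀ : ℕ) (u₀ : ℝ) (n : ℕ) : ℝ :=
  (∏ k ∈ Finset.range n, decFactor c₁ K νv ν' ℓ₀ k) * u₀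

/-- The decreasing sequence of levels `u_n⁻`. -/
def uMinusSeq (c₁ K νv ν' : ℝ) (ℓ₀ : ℕ) (u₀ : ℝ) (n : ℕ) : ℝ :=
  (∏ k ∈ Finset.range n, (decFactor c₁ K νv ν' ℓ₀ k)⁻¹) * u₀

/-- The limit `u_∞⁺` of `u_n⁺`. -/
def uPlusInf (c₁ K νv ν' : ℝ) (ℓ₀ : ℕ) (u₀ : ℝ) : ℝ := ⨆ n, uPlusSeq c₁ K νv ν' ℓ₀ u₀ n

/-- The limit `u_∞⁻` of `u_n⁻`. -/
def uMinusInf (c₁ K νv ν' : ℝ) (ℓ₀ : ℕ) (u₀ : ℝ) : ℝ := ⨅ n, uMinusSeq c₁ K νv ν' ℓ₀ u₀ n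

/-- The error term `ε(u) = 2 e^{-K u L₀^ν ℓ₀^{ν'}} / (1 - e^{-K u L₀^ν ℓ₀^{ν'}})`. -/
def epsDecouple (K u : ℝ) (L₀ ℓ₀ : ℕ) (νv ν' : ℝ) : ℝ :=
  2 * Real.exp (-(K * u * (L₀ : ℝ) ^ νv * (ℓ₀ : ℝ) ^ ν')) /
    (1 - Real.exp (-(K * u * (L₀ : ℝ) ^ νv * (ℓ₀ : ℝ) ^ ν')))

/-- The canonical law of the random walk on `E`, as a family of measures on trajectories. -/
structure WalkLaw (S : GraphSetup) where
  P : S.E → Measure (ℕ → S.E)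
  isProb : ∀ x, IsProbabilityMeasure (P x)
  cyl : ∀ (x : S.E) (n : ℕ) (q : ℕ → S.E), q 0 = x →
    P x {w | ∀ i ≤ n, w i = q i} =
      ENNReal.ofReal (∏ i ∈ Finset.range n, S.ptrans (q i) (q (i + 1)))
  cyl0 : ∀ (x : S.E) (q : ℕ → S.E), q 0 ≠ x → P x {w | w 0 = q 0} = 0

instance {S : GraphSetup} (W : WalkLaw S) (x : S.E) : IsProbabilityMeasure (W.P x) :=
  W.isProb x

namespace WalkLaw

variable {S : GraphSetup}

/-- `P_x[H_K < ∞]`, the probability to ever enter `K`. -/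
def hitProb (W : WalkLaw S) (x : S.E) (K : Set S.E) : ℝ≥0∞ := W.P x {w | ∃ n, w n ∈ K}

/-- `P_x[H̃_K = ∞]`, the probability never to hit `K` at a positive time. -/
def escProb (W : WalkLaw S) (x : S.E) (K : Set S.E) : ℝ≥0∞ :=
  W.P x {w | ∀ n, 1 ≤ n → w n ∉ K}

/-- `P_x[H_K < ∞, X_{H_K} = x']`, the probability to enter `K` for the first time at `x'`. -/
def entersAt (W : WalkLaw S) (x : S.E) (K : Set S.E) (x' : S.E) : ℝ≥0∞ :=
  W.P x {w | ∃ n, w n = x' ∧ ∀ m < n, w m ∉ K}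

/-- The equilibrium measure `e_K`. -/
def equilibrium (W : WalkLaw S) (K : Set S.E) (x : S.E) : ℝ :=
  if x ∈ K then (W.escProb x K).toReal * S.ρEpt x else 0

/-- The capacity `cap(K) = Σ_{x ∈ K} P_x[H̃_K = ∞] ρ(x)`. -/
def capacity (W : WalkLaw S) (K : Set S.E) : ℝ :=
  ∑' x : K, (W.escProb x.1 K).toReal * S.ρEpt x.1

/-- The Green density `g(x,x') = Σ_{n ≥ 0} P_x[X_n = x'] / ρ(x')`. -/
def green (W : WalkLaw S) (x x' : S.E) : ℝ :=
  (∑' n : ℕ, (W.P x {w | w n = x'}).toReal) / S.ρEpt x'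

/-- The standing assumption `c (d(x,x') ∨ 1)^{-ν} ≤ g(x,x') ≤ c' (d(x,x') ∨ 1)^{-ν}`. -/
def GreenBounds (W : WalkLaw S) (cg cg' : ℝ) : Prop :=
  0 < cg ∧ cg ≤ cg' ∧ ∀ x x' : S.E,
    cg * (max (S.dE x x') 1) ^ (-S.ν) ≤ W.green x x' ∧
      W.green x x' ≤ cg' * (max (S.dE x x') 1) ^ (-S.ν)

end WalkLaw

/-- Random interlacements on `E`, encoded by their canonical probability space and the
family of interlacement sets `ℐ^u`, `u ≥ 0`, with
`ℙ[𝒱^u ⊇ K] = exp(-u cap(K))` for all finite `K`. -/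
structure Interlacement (S : GraphSetup) (W : WalkLaw S) where
  Ω : Type
  mΩ : MeasurableSpace Ω
  prob : @Measure Ω mΩ
  isProb : IsProbabilityMeasure prob
  I : ℝ → Ω → Set S.E
  I_mono : ∀ u u' : ℝ, u ≤ u' → ∀ ω, I u ω ⊆ I u' ω
  vacant_law : ∀ u : ℝ, 0 ≤ u → ∀ K : Set S.E, K.Finite →
    prob {ω | Disjoint K (I u ω)} = ENNReal.ofReal (Real.exp (-(u * W.capacity K)))

namespace Interlacement

variable {S : GraphSetup} {W : WalkLaw S}

/-- The vacant set `𝒱^u = E ∖ ℐ^u`. -/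
def vacant (RI : Interlacement S W) (u : ℝ) (ω : RI.Ω) : Set S.E := (RI.I u ω)ᶜ

/-- The event that `x` lies in an infinite connected component of `𝒱^u`. -/
def percolates (RI : Interlacement S W) (x : S.E) (u : ℝ) : Set RI.Ω :=
  {ω | (S.component (RI.vacant u ω) x).Infinite}

/-- The one-arm event: `B(x,L)` is connected to `∂_int B(x,2L)` in `𝒱^u`. -/
def oneArm (RI : Interlacement S W) (x : S.E) (L : ℝ) (u : ℝ) : Set RI.Ω :=
  {ω | S.ConnectsIn (RI.vacant u ω) (S.ball x L) (S.intBoundary (S.ball x (2 * L)))}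

/-- `sup_{x ∈ E} ℙ[B(x,L) ↔ ∂_int B(x,2L) in 𝒱^u]`. -/
def oneArmSup (RI : Interlacement S W) (u : ℝ) (L : ℕ) : ℝ≥0∞ :=
  ⨆ x : S.E, RI.prob (RI.oneArm x L u)

/-- The set defining `u_*`. -/
def uStarSet (RI : Interlacement S W) : Set ℝ :=
  {u | 0 ≤ u ∧ ∀ x : S.E, RI.prob (RI.percolates x u) = 0}

/-- The critical level `u_*`. -/
def uStar (RI : Interlacement S W) : ℝ := sInf RI.uStarSet

/-- The set defining `u_**`. -/
def uStarStarSet (RI : Interlacement S W) : Set ℝ :=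
  {u | 0 ≤ u ∧ Filter.liminf (fun L : ℕ => RI.oneArmSup u L) Filter.atTop = 0}

/-- The critical level `u_**`. -/
def uStarStar (RI : Interlacement S W) : ℝ := sInf RI.uStarStarSet

/-- The `*`-crossing event for `ℐ^u` inside a half-plane. -/
def starCross (RI : Interlacement S W) (P : S.HalfPlane) (x : S.E) (L : ℝ) (u : ℝ) :
    Set RI.Ω :=
  {ω | S.StarConnectsIn P (RI.I u ω) (S.ball x L) (S.intBoundary (S.ball x (2 * L)))}

/-- `sup_{𝒫, x ∈ 𝒫} ℙ[B(x,L) ↔* ∂_int B(x,2L) in ℐ^u ∩ 𝒫]`. -/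
def starSup (RI : Interlacement S W) (u : ℝ) (L : ℕ) : ℝ≥0∞ :=
  ⨆ P : S.HalfPlane, ⨆ x : P.carrier, RI.prob (RI.starCross P x.1 L u)

/-- The set defining `ũ`. -/
def uTildeSet (RI : Interlacement S W) : Set ℝ :=
  {u | 0 ≤ u ∧ 0 < Filter.liminf (fun L : ℕ => RI.starSup u L) Filter.atTop}

/-- The critical level `ũ`. -/
def uTilde (RI : Interlacement S W) : ℝ := sInf RI.uTildeSet

/-- For an event `A` on `{0,1}^E`, the event `A^u` that the indicator of `ℐ^u` lies in `A`. -/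
def eventAt (RI : Interlacement S W) (A : Set (Set S.E)) (u : ℝ) : Set RI.Ω :=
  {ω | RI.I u ω ∈ A}

end Interlacement

end GraphSetup

open GraphSetup

namespace GraphSetup

variable (S : GraphSetup)

theorem dG_self (y : S.V) : S.dG y y = 0 :=
  Nat.le_zero.1 ((S.dG_spec y y 0).2 ⟨fun _ => y, rfl, rfl, fun _ h => absurd h (Nat.not_lt_zero _)⟩)

theorem dG_le_one_of_adjG {y y' : S.V} (h : S.adjG y y') : S.dG y y' ≤ 1 :=
  (S.dG_spec y y' 1).2 ⟨fun i => if i = 0 then y else y', by simp, by simp, fun i hi => by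
    obtain rfl : i = 0 := by omega
    simpa using Or.inr h⟩

theorem dG_comm_le (y y' : S.V) : S.dG y' y ≤ S.dG y y' := by
  obtain ⟨p, h0, hn, hp⟩ := (S.dG_spec y y' _).1 le_rfl
  refine (S.dG_spec y' y _).2 ⟨fun i => p (S.dG y y' - i), by simpa using hn, by simpa using h0,
    fun i hi => ?_⟩
  have h := hp (S.dG y y' - (i + 1)) (by omega)
  rw [show S.dG y y' - (i + 1) + 1 = S.dG y y' - i by omega] at h
  exact h.imp Eq.symm S.adjG_symm

theorem dG_comm (y y' : S.V) : S.dG y y' = S.dG y' y :=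
  le_antisymm (S.dG_comm_le _ _) (S.dG_comm_le _ _)

theorem dG_triangle (y y' y'' : S.V) : S.dG y y'' ≤ S.dG y y' + S.dG y' y'' := by
  obtain ⟨p, hp0, hpn, hp⟩ := (S.dG_spec y y' _).1 le_rfl
  obtain ⟨q, hq0, hqn, hq⟩ := (S.dG_spec y' y'' _).1 le_rfl
  refine (S.dG_spec y y'' _).2
    ⟨fun i => if i ≤ S.dG y y' then p i else q (i - S.dG y y'), by simpa using hp0, ?_, ?_⟩
  · by_cases h : S.dG y' y'' = 0
    · rw [h] at hqn
      simp only [h, Nat.add_zero, le_refl, if_true]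
      rw [hpn, ← hq0, hqn]
    · simp only [Nat.add_sub_cancel_left]
      rw [if_neg (by omega)]
      exact hqn
  · intro i hi
    rcases lt_trichotomy i (S.dG y y') with h | h | h
    · simpa [h.le, Nat.succ_le_of_lt h] using hp i h
    · have h1 := hq 0 (by omega)
      rw [hq0, ← hpn] at h1
      simpa [h] using h1
    · have h1 := hq (i - S.dG y y') (by omega)
      rw [show i - S.dG y y' + 1 = i + 1 - S.dG y y' by omega] at h1
      simpa [h.not_ge, show ¬ i + 1 ≤ S.dG y y' by omega] using h1

/-- A geodesic path from `y` to `y'`. -/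
theorem exists_geodesic (y y' : S.V) : ∃ p : ℕ → S.V, p 0 = y ∧ p (S.dG y y') = y' ∧
    (∀ i < S.dG y y', S.adjG (p i) (p (i + 1))) ∧ ∀ i ≤ S.dG y y', S.dG y (p i) = i := by
  obtain ⟨p, h0, hn, hp⟩ := (S.dG_spec y y' _).1 le_rfl
  have hd : ∀ i ≤ S.dG y y', S.dG y (p i) = i := by
    intro i hi
    have h1 : S.dG y (p i) ≤ i :=
      (S.dG_spec _ _ _).2 ⟨p, h0, rfl, fun j hj => hp j (by omega)⟩
    have h2 : S.dG (p i) y' ≤ S.dG y y' - i :=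
      (S.dG_spec _ _ _).2 ⟨fun j => p (i + j), rfl, by simp only [Nat.add_sub_cancel' hi, hn],
        fun j hj => hp (i + j) (by omega)⟩
    have h3 := S.dG_triangle y (p i) y'
    omega
  refine ⟨p, h0, hn, fun i hi => (hp i hi).resolve_left fun h => ?_, hd⟩
  have h1 := hd i hi.le
  have h2 := hd (i + 1) hi
  rw [← h] at h2
  omega

theorem exists_far (y : S.V) (n : ℕ) : ∃ y', n ≤ S.dG y y' := by
  by_contra! h
  have := S.infV
  refine Set.infinite_univ ((S.ballG_fin y n).subset fun y' _ => ?_)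
  exact_mod_cast (h y').le

/-- A geodesic segment of length `n` started at `y`. -/
theorem exists_geodesic_length (y : S.V) (n : ℕ) : ∃ p : ℕ → S.V, p 0 = y ∧
    (∀ i < n, S.adjG (p i) (p (i + 1))) ∧ ∀ i ≤ n, S.dG y (p i) = i := by
  obtain ⟨y', hy'⟩ := S.exists_far y n
  obtain ⟨p, h0, -, hp, hd⟩ := S.exists_geodesic y y'
  exact ⟨p, h0, fun i hi => hp i (by omega), fun i hi => hd i (by omega)⟩

/-- The vertical part of the metric `dE`. -/
def dZ (z z' : ℤ) : ℝ := |(z : ℝ) - (z' : ℝ)| ^ (2 / S.β)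

theorem β_pos : 0 < S.β := by linarith [S.β_ge_two]

theorem exponent_pos : 0 < 2 / S.β := div_pos two_pos S.β_pos

theorem exponent_le_one : 2 / S.β ≤ 1 := (div_le_one S.β_pos).2 S.β_ge_two

theorem dZ_self (z : ℤ) : S.dZ z z = 0 := by
  simp [dZ, Real.zero_rpow S.exponent_pos.ne']

theorem dZ_comm (z z' : ℤ) : S.dZ z z' = S.dZ z' z := by
  rw [dZ, dZ, abs_sub_comm]

theorem dZ_triangle (z z' z'' : ℤ) : S.dZ z z'' ≤ S.dZ z z' + S.dZ z' z'' := by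
  have h1 : |(z : ℝ) - z''| ≤ |(z : ℝ) - z'| + |(z' : ℝ) - z''| := abs_sub_le _ _ _
  exact (Real.rpow_le_rpow (abs_nonneg _) h1 S.exponent_pos.le).trans
    (Real.rpow_add_le_add_rpow (abs_nonneg _) (abs_nonneg _) S.exponent_pos.le S.exponent_le_one)

theorem dZ_le_iff {z z' : ℤ} {r : ℝ} (hr : 0 ≤ r) :
    S.dZ z z' ≤ r ↔ |(z : ℝ) - z'| ≤ r ^ (S.β / 2) := by
  have := Real.le_rpow_inv_iff_of_pos (abs_nonneg ((z : ℝ) - z')) hr S.exponent_pos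
  rw [inv_div] at this
  exact this.symm

theorem dZ_eq_one {z z' : ℤ} (h : (z - z').natAbs = 1) : S.dZ z z' = 1 := by
  have : |(z : ℝ) - z'| = 1 := by
    rw [← Int.cast_sub, ← Int.cast_abs, Int.abs_eq_natAbs, h]; simp
  rw [dZ, this, Real.one_rpow]

theorem dZ_le_of_mem_Icc {z z' t u : ℤ} {r : ℝ} (hz : S.dZ u z ≤ r) (hz' : S.dZ u z' ≤ r)
    (h : z ≤ t) (h' : t ≤ z') : S.dZ u t ≤ r := by
  have hr : 0 ≤ r := (Real.rpow_nonneg (abs_nonneg _) _).trans hz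
  rw [S.dZ_le_iff hr, abs_le] at *
  have h1 : (z : ℝ) ≤ t := by exact_mod_cast h
  have h2 : (t : ℝ) ≤ z' := by exact_mod_cast h'
  constructor <;> linarith [hz.2, hz'.1]

theorem dE_le_iff {a b : S.E} {r : ℝ} :
    S.dE a b ≤ r ↔ (S.dG a.1 b.1 : ℝ) ≤ r ∧ S.dZ a.2 b.2 ≤ r := max_le_iff

theorem lt_dE_iff {a b : S.E} {r : ℝ} :
    r < S.dE a b ↔ r < (S.dG a.1 b.1 : ℝ) ∨ r < S.dZ a.2 b.2 := lt_max_iff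

theorem dE_comm (a b : S.E) : S.dE a b = S.dE b a := by
  simp only [dE, S.dG_comm a.1, abs_sub_comm (a.2 : ℝ)]

theorem dE_triangle (a b c : S.E) : S.dE a c ≤ S.dE a b + S.dE b c := by
  have h1 := S.dE_le_iff.1 (le_refl (S.dE a b))
  have h2 := S.dE_le_iff.1 (le_refl (S.dE b c))
  refine S.dE_le_iff.2 ⟨?_, ?_⟩
  · have : (S.dG a.1 c.1 : ℝ) ≤ S.dG a.1 b.1 + S.dG b.1 c.1 := by
      exact_mod_cast S.dG_triangle _ _ _
    linarith
  · linarith [S.dZ_triangle a.2 b.2 c.2]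

theorem dE_self (a : S.E) : S.dE a a = 0 := by
  have := S.dZ_self a.2
  rw [dZ] at this
  rw [dE, this, S.dG_self]
  simp

theorem adjE_symm {a b : S.E} (h : S.adjE a b) : S.adjE b a := by
  rcases h with ⟨h1, h2⟩ | ⟨h1, h2⟩
  · exact Or.inl ⟨h1.symm, S.adjG_symm h2⟩
  · exact Or.inr ⟨h1.symm, by omega⟩

theorem dE_le_one_of_adjE {a b : S.E} (h : S.adjE a b) : S.dE a b ≤ 1 := by
  refine S.dE_le_iff.2 ?_
  rcases h with ⟨h1, h2⟩ | ⟨h1, h2⟩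
  · rw [h1, S.dZ_self]
    exact ⟨by exact_mod_cast S.dG_le_one_of_adjG h2, zero_le_one⟩
  · rw [h1, S.dG_self, S.dZ_eq_one h2]
    simp

theorem ball_subset_ball {a b : S.E} {r s : ℝ} (h : S.dE b a + r ≤ s) :
    S.ball a r ⊆ S.ball b s := fun c hc => by
  have h1 : S.dE a c ≤ r := hc
  have h2 := S.dE_triangle b a c
  show S.dE b c ≤ s
  linarith

theorem cl_mono {A B : Set S.E} (h : A ⊆ B) : S.cl A ⊆ S.cl B := by
  rintro a (ha | ⟨-, b, hb, hab⟩)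
  · exact Or.inl (h ha)
  · by_cases ha : a ∈ B
    · exact Or.inl ha
    · exact Or.inr ⟨ha, b, h hb, hab⟩

theorem mem_cl_of_adjE {A : Set S.E} {a b : S.E} (hb : b ∈ A) (h : S.adjE a b) : a ∈ S.cl A := by
  by_cases ha : a ∈ A
  · exact Or.inl ha
  · exact Or.inr ⟨ha, b, hb, h⟩

theorem cl_ball_subset (a : S.E) (r : ℝ) : S.cl (S.ball a r) ⊆ S.ball a (r + 1) := by
  rintro b (hb | ⟨-, c, hc, hbc⟩)
  · have h1 : S.dE a b ≤ r := hb
    show S.dE a b ≤ r + 1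
    linarith
  · have h1 : S.dE a c ≤ r := hc
    have h2 := S.dE_triangle a c b
    have h3 := S.dE_le_one_of_adjE (S.adjE_symm hbc)
    show S.dE a b ≤ r + 1
    linarith

/-- Adjacency inside the set `A`. -/
def Link (A : Set S.E) (a b : S.E) : Prop := S.adjE a b ∧ a ∈ A ∧ b ∈ A

theorem link_reverse {A : Set S.E} {a b : S.E} (h : Relation.ReflTransGen (S.Link A) a b) :
    Relation.ReflTransGen (S.Link A) b a := by
  induction h with
  | refl => exact .refl
  | tail _ h ih => exact .head ⟨S.adjE_symm h.1, h.2.2, h.2.1⟩ ih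

theorem connectsIn_of_link {A : Set S.E} {a b : S.E} (ha : a ∈ A)
    (h : Relation.ReflTransGen (S.Link A) a b) : S.ConnectsIn A {a} {b} := by
  induction h with
  | refl => exact ⟨0, fun _ => a, ⟨fun _ _ => ha, fun _ h => absurd h (Nat.not_lt_zero _)⟩, rfl, rfl⟩
  | @tail b c _ hbc ih =>
    obtain ⟨n, p, ⟨hp, hp'⟩, h0, hn⟩ := ih
    refine ⟨n + 1, fun i => if i ≤ n then p i else c, ⟨fun i hi => ?_, fun i hi => ?_⟩, ?_, ?_⟩
    · dsimp only
      split_ifs with h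
      · exact hp i h
      · exact hbc.2.2
    · rcases Nat.lt_or_ge i n with h | h
      · simpa [h.le, Nat.succ_le_of_lt h] using hp' i h
      · obtain rfl : i = n := by omega
        have : p i = b := hn
        simpa [this] using hbc.1
    · simpa using h0
    · simp

theorem link_of_connectsIn {A : Set S.E} {a b : S.E} (h : S.ConnectsIn A {a} {b}) :
    Relation.ReflTransGen (S.Link A) a b := by
  obtain ⟨n, p, ⟨hp, hp'⟩, h0, hn⟩ := h
  obtain rfl : p 0 = a := h0
  obtain rfl : p n = b := hn
  have : ∀ i ≤ n, Relation.ReflTransGen (S.Link A) (p 0) (p i) := by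
    intro i
    induction i with
    | zero => exact fun _ => .refl
    | succ i ih => exact fun hi => (ih (by omega)).tail ⟨hp' i hi, hp i (by omega), hp _ hi⟩
  exact this n le_rfl

theorem isConnectedSet_of_link {A : Set S.E} (e : S.E)
    (h : ∀ a ∈ A, Relation.ReflTransGen (S.Link A) e a) : S.IsConnectedSet A :=
  fun a ha b hb => S.connectsIn_of_link ha ((S.link_reverse (h a ha)).trans (h b hb))

/-- A connected set reaching distance `r` from one of its points `e` contains a connected piece
around `e` that reaches distance `r` without leaving the closure of the ball of radius `r`. -/
theorem IsConnectedSet.exists_piece {S : GraphSetup} {A : Set S.E} (hA : S.IsConnectedSet A)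
    {e f : S.E} (he : e ∈ A) (hf : f ∈ A) {r : ℝ} (hr : 0 ≤ r) (hef : r ≤ S.dE e f) :
    ∃ A' ⊆ A, S.IsConnectedSet A' ∧ A' ⊆ S.cl (S.ball e r) ∧ e ∈ A' ∧
      ∃ f' ∈ A', r ≤ S.dE e f' := by
  set R : S.E → S.E → Prop := fun u v => S.adjE u v ∧ v ∈ A ∧ S.dE e u < r with hR
  set A' : Set S.E := {t | Relation.ReflTransGen R e t} with hA'
  have heA' : e ∈ A' := .refl
  refine ⟨A', fun t ht => ?_, S.isConnectedSet_of_link e fun t ht => ?_, fun t ht => ?_, heA', ?_⟩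
  · rcases Relation.ReflTransGen.cases_tail ht with h | ⟨u, -, hu⟩
    · exact h ▸ he
    · exact hu.2.1
  · induction ht with
    | refl => exact .refl
    | tail h1 h2 ih => exact ih.tail ⟨h2.1, h1, h1.tail h2⟩
  · rcases Relation.ReflTransGen.cases_tail ht with h | ⟨u, -, hu⟩
    · exact Or.inl (by rw [h]; exact (S.dE_self e).trans_le hr)
    · exact S.mem_cl_of_adjE (b := u) hu.2.2.le (S.adjE_symm hu.1)
  · by_contra! hlt
    have : ∀ t, Relation.ReflTransGen (S.Link A) e t → t ∈ A' := by
      intro t ht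
      induction ht with
      | refl => exact heA'
      | tail _ h2 ih => exact Relation.ReflTransGen.tail ih ⟨h2.1, h2.2.2, hlt _ ih⟩
    exact (hlt f (this f (S.link_of_connectsIn (hA e he f hf)))).not_ge hef

end GraphSetup

namespace GraphSetup

variable (S : GraphSetup)

theorem link_vertical {A : Set S.E} {y : S.V} {z z' : ℤ} (hz : z ≤ z')
    (h : ∀ t, z ≤ t → t ≤ z' → (y, t) ∈ A) :
    Relation.ReflTransGen (S.Link A) (y, z) (y, z') := by
  induction z', hz using Int.leInduction with
  | base => exact .refl
  | succ n hn ih =>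
    exact (ih fun t h1 h2 => h t h1 (by omega)).tail
      ⟨Or.inr ⟨rfl, by simp⟩, h n hn (by omega), h _ (by omega) le_rfl⟩

theorem link_horizontal {A : Set S.E} {p : ℕ → S.V} {z : ℤ} {n : ℕ}
    (hp : ∀ i < n, S.adjG (p i) (p (i + 1))) (h : ∀ i ≤ n, (p i, z) ∈ A) :
    ∀ i ≤ n, Relation.ReflTransGen (S.Link A) (p 0, z) (p i, z) := by
  intro i
  induction i with
  | zero => exact fun _ => .refl
  | succ i ih =>
    exact fun hi => (ih (by omega)).tail ⟨Or.inl ⟨rfl, hp i hi⟩, h i (by omega), h _ hi⟩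

/-- The region of a ball outside another ball of less than half its radius is connected. -/
theorem link_avoiding {x q : S.E} {R : ℕ} {r : ℝ} (hR : 2 * r + 1 ≤ R) {a b : S.E}
    (ha : a ∈ {p | S.dE x p ≤ R ∧ r < S.dE q p}) (hb : b ∈ {p | S.dE x p ≤ R ∧ r < S.dE q p}) :
    Relation.ReflTransGen (S.Link {p | S.dE x p ≤ R ∧ r < S.dE q p}) a b := by
  set A : Set S.E := {p | S.dE x p ≤ R ∧ r < S.dE q p} with hA
  have hR0 : (0 : ℝ) ≤ R := Nat.cast_nonneg R
  have hmem : ∀ y z, ((y, z) : S.E) ∈ A ↔ ((S.dG x.1 y : ℝ) ≤ R ∧ S.dZ x.2 z ≤ R) ∧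
      (r < (S.dG q.1 y : ℝ) ∨ r < S.dZ q.2 z) := fun y z => by
    rw [hA, Set.mem_ofPred_eq, S.dE_le_iff, S.lt_dE_iff]
  obtain ⟨y0, hy0, hy0'⟩ : ∃ y, (S.dG x.1 y : ℝ) ≤ R ∧ r < (S.dG q.1 y : ℝ) := by
    by_contra! h
    obtain ⟨p, -, -, hp⟩ := S.exists_geodesic_length x.1 R
    have h1 := h x.1 (by rw [S.dG_self]; simp)
    have h2 := h (p R) (by rw [hp R le_rfl])
    have h3 : (S.dG x.1 (p R) : ℝ) ≤ S.dG x.1 q.1 + S.dG q.1 (p R) := by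
      exact_mod_cast S.dG_triangle _ _ _
    rw [hp R le_rfl, S.dG_comm x.1] at h3
    linarith
  obtain ⟨z0, hz0, hz0'⟩ : ∃ z, S.dZ x.2 z ≤ R ∧ r < S.dZ q.2 z := by
    by_contra! h
    set N : ℕ := ⌊(R : ℝ) ^ (S.β / 2)⌋₊ with hN
    have hN1 : (N : ℝ) ≤ (R : ℝ) ^ (S.β / 2) := Nat.floor_le (by positivity)
    have hN2 : (R : ℝ) ^ (S.β / 2) < (N : ℝ) + 1 := Nat.lt_floor_add_one _
    have h1 := h x.2 (by rw [S.dZ_self]; exact hR0)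
    have h2 := h (x.2 + N) (by
      rw [S.dZ_le_iff hR0]
      simpa using hN1)
    have h3 := S.dZ_triangle x.2 q.2 (x.2 + N)
    have h4 : S.dZ (x.2 + N) (x.2 + N + 1) = 1 := S.dZ_eq_one (by simp)
    have h5 := S.dZ_triangle x.2 (x.2 + N) (x.2 + N + 1)
    have h6 : ¬ S.dZ x.2 (x.2 + N + 1) ≤ R := by
      rw [S.dZ_le_iff hR0, not_le]
      refine hN2.trans_le (le_of_eq ?_)
      push_cast
      rw [show (x.2 : ℝ) - (x.2 + N + 1) = -(N + 1) by ring, abs_neg, abs_of_nonneg (by positivity)]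
    rw [S.dZ_comm x.2 q.2] at h3
    linarith
  have vert : ∀ y z z', (S.dG x.1 y : ℝ) ≤ R → r < (S.dG q.1 y : ℝ) → S.dZ x.2 z ≤ R →
      S.dZ x.2 z' ≤ R → Relation.ReflTransGen (S.Link A) (y, z) (y, z') := by
    intro y z z' h1 h2 h3 h4
    rcases le_total z z' with h | h
    · exact S.link_vertical h fun t ht ht' =>
        (hmem _ _).2 ⟨⟨h1, S.dZ_le_of_mem_Icc h3 h4 ht ht'⟩, Or.inl h2⟩
    · exact S.link_reverse (S.link_vertical h fun t ht ht' =>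
        (hmem _ _).2 ⟨⟨h1, S.dZ_le_of_mem_Icc h4 h3 ht ht'⟩, Or.inl h2⟩)
  have horiz' : ∀ y z, (S.dG x.1 y : ℝ) ≤ R → S.dZ x.2 z ≤ R → r < S.dZ q.2 z →
      Relation.ReflTransGen (S.Link A) (x.1, z) (y, z) := by
    intro y z h1 h2 h3
    obtain ⟨p, hp0, hpn, hp, hd⟩ := S.exists_geodesic x.1 y
    have := S.link_horizontal (A := A) (z := z) hp (fun i hi =>
      (hmem _ _).2 ⟨⟨by rw [hd i hi]; exact le_trans (by exact_mod_cast hi) h1, h2⟩, Or.inr h3⟩)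
      _ le_rfl
    rwa [hp0, hpn] at this
  have horiz : ∀ y y' z, (S.dG x.1 y : ℝ) ≤ R → (S.dG x.1 y' : ℝ) ≤ R → S.dZ x.2 z ≤ R →
      r < S.dZ q.2 z → Relation.ReflTransGen (S.Link A) (y, z) (y', z) :=
    fun y y' z h1 h2 h3 h4 => (S.link_reverse (horiz' y z h1 h3 h4)).trans (horiz' y' z h2 h3 h4)
  have hub : ∀ a ∈ A, Relation.ReflTransGen (S.Link A) a (y0, z0) := by
    rintro ⟨y, z⟩ h
    obtain ⟨⟨h1, h2⟩, h3 | h3⟩ := (hmem y z).1 h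
    · exact (vert y z z0 h1 h3 h2 hz0).trans (horiz y y0 z0 h1 hy0 hz0 hz0')
    · exact (horiz y y0 z h1 hy0 h2 h3).trans (vert y0 z z0 hy0 hy0' h2 hz0)
  exact (hub a ha).trans (S.link_reverse (hub b hb))

/-- Around each point there is a connected set of prescribed diameter in the ball. -/
theorem exists_segment (a : S.E) (L : ℕ) : ∃ K : Set S.E, a ∈ K ∧ S.IsConnectedSet K ∧
    K ⊆ S.ball a L ∧ ∃ b ∈ K, (L : ℝ) ≤ S.dE a b := by
  obtain ⟨p, h0, hp, hd⟩ := S.exists_geodesic_length a.1 L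
  have ha : (p 0, a.2) = a := by rw [h0]
  refine ⟨{t | ∃ i ≤ L, t = (p i, a.2)}, ⟨0, Nat.zero_le _, ha.symm⟩,
    S.isConnectedSet_of_link a ?_, ?_, (p L, a.2), ⟨L, le_rfl, rfl⟩, ?_⟩
  · rintro _ ⟨i, hi, rfl⟩
    have := S.link_horizontal (A := {t | ∃ i ≤ L, t = (p i, a.2)}) (z := a.2) hp
      (fun i hi => ⟨i, hi, rfl⟩) i hi
    rwa [ha] at this
  · rintro _ ⟨i, hi, rfl⟩
    refine S.dE_le_iff.2 ⟨?_, ?_⟩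
    · rw [hd i hi]
      exact_mod_cast hi
    · rw [S.dZ_self]
      positivity
  · exact le_max_of_le_left (by rw [hd L le_rfl])

/-- The points reachable from `A` by steps into `U \ C`. -/
def explored (A U C : Set S.E) : Set S.E :=
  {t | ∃ s ∈ A, Relation.ReflTransGen (fun u v => S.adjE u v ∧ v ∈ U ∧ v ∉ C) s t}

variable {S} {A A' U C : Set S.E}

theorem subset_explored : A ⊆ S.explored A U C := fun a ha => ⟨a, ha, .refl⟩

theorem explored_step {u v : S.E} (hu : u ∈ S.explored A U C) (h : S.adjE u v) (hv : v ∈ U)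
    (hv' : v ∉ C) : v ∈ S.explored A U C := by
  obtain ⟨s, hs, h1⟩ := hu
  exact ⟨s, hs, h1.tail ⟨h, hv, hv'⟩⟩

theorem IsConnectedSet.explored (hA : S.IsConnectedSet A) :
    S.IsConnectedSet (S.explored A U C) := by
  rcases A.eq_empty_or_nonempty with rfl | ⟨a, ha⟩
  · rintro t ⟨s, hs, -⟩
    exact absurd hs (Set.notMem_empty s)
  refine S.isConnectedSet_of_link a fun t ht => ?_
  obtain ⟨s, hs, h⟩ := ht
  induction h with
  | refl =>
    refine Relation.ReflTransGen.mono (fun u v h => ?_) _ _ (S.link_of_connectsIn (hA a ha s hs))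
    exact ⟨h.1, subset_explored h.2.1, subset_explored h.2.2⟩
  | tail h1 h2 ih => exact ih.tail ⟨h2.1, ⟨s, hs, h1⟩, ⟨s, hs, h1.tail h2⟩⟩

/-- A separating set keeps the explored region away from the closure of the other set. -/
theorem Separates.disjoint_explored (h : S.Separates A A' C U) :
    Disjoint (S.explored A U C) (S.cl A') := by
  have key : ∀ s ∈ A, ∀ t,
      Relation.ReflTransGen (fun u v => S.adjE u v ∧ v ∈ U ∧ v ∉ C) s t →
      t ∉ S.cl A' ∧ (t ∈ A ∨ ∃ (n : ℕ) (p : ℕ → S.E), (∀ i ≤ n, p i ∈ U ∧ p i ∉ C) ∧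
        (∀ i < n, S.adjE (p i) (p (i + 1))) ∧ p 0 ∈ S.vBoundary A ∧ p n = t) := by
    have hA : ∀ t ∈ A, t ∉ S.cl A' := by
      rintro t ht (ht' | ⟨-, b, hb, htb⟩)
      · exact (h.1 t ht t ht').1 rfl
      · exact (h.1 t ht b hb).2 htb
    intro s hs t hst
    induction hst with
    | refl => exact ⟨hA s hs, Or.inl hs⟩
    | @tail u v _ huv ih =>
      obtain ⟨hu, ih⟩ := ih
      have hvA' : v ∉ A' := fun hv => hu (S.mem_cl_of_adjE hv huv.1)
      by_cases hvA : v ∈ A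
      · exact ⟨hA v hvA, Or.inl hvA⟩
      have hpath : ∃ (n : ℕ) (p : ℕ → S.E), (∀ i ≤ n, p i ∈ U ∧ p i ∉ C) ∧
          (∀ i < n, S.adjE (p i) (p (i + 1))) ∧ p 0 ∈ S.vBoundary A ∧ p n = v := by
        rcases ih with huA | ⟨n, p, hp, hp', h0, hn⟩
        · exact ⟨0, fun _ => v, fun _ _ => huv.2, fun _ h => absurd h (Nat.not_lt_zero _),
            ⟨hvA, u, huA, S.adjE_symm huv.1⟩, rfl⟩
        · refine ⟨n + 1, fun i => if i ≤ n then p i else v, fun i hi => ?_, fun i hi => ?_, ?_, ?_⟩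
          · dsimp only
            split_ifs with h
            · exact hp i h
            · exact huv.2
          · rcases Nat.lt_or_ge i n with h | h
            · simpa [h.le, Nat.succ_le_of_lt h] using hp' i h
            · obtain rfl : i = n := by omega
              simpa [hn] using huv.1
          · simpa using h0
          · simp
      refine ⟨?_, Or.inr hpath⟩
      rintro (hv | hv)
      · exact hvA' hv
      · obtain ⟨n, p, hp, hp', h0, rfl⟩ := hpath
        obtain ⟨i, hi, hiC⟩ := h.2 n p (fun i hi => (hp i hi).1) hp' h0 hv
        exact (hp i hi).2 hiC
  rw [Set.disjoint_left]
  rintro t ⟨s, hs, ht⟩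
  exact (key s hs t ht).1

/-- Pieces of the explored region are separated from sets whose closure is unexplored. -/
theorem separates_of_disjoint_explored {D K W : Set S.E} (hW : W ⊆ U)
    (hD : D ⊆ S.explored A U C) (hK : Disjoint (S.explored A U C) (S.cl K)) :
    S.Separates D K C W := by
  rw [Set.disjoint_left] at hK
  refine ⟨fun a ha b hb => ⟨?_, fun hab => hK (hD ha) (S.mem_cl_of_adjE hb hab)⟩, ?_⟩
  · rintro rfl
    exact hK (hD ha) (Or.inl hb)
  · intro n p hp hp' h0 hn
    by_contra! hC
    obtain ⟨-, d, hd, hd'⟩ := h0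
    have : ∀ i ≤ n, p i ∈ S.explored A U C := by
      intro i
      induction i with
      | zero =>
        exact fun hi => explored_step (hD hd) (S.adjE_symm hd') (hW (hp 0 hi)) (hC 0 hi)
      | succ i ih =>
        exact fun hi => explored_step (ih (by omega)) (hp' i hi) (hW (hp _ hi)) (hC _ hi)
    exact hK (this n le_rfl) (Or.inr hn)

end GraphSetup

namespace GraphSetup

variable (S : GraphSetup)

/-- Assembling a separation event at scale `L` near a point `p` where an explored region and a
connected set with unexplored closure are both within reach. -/
theorem mem_sepEvent_of_explored {A U C K : Set S.E} {L : ℕ} {p w e f k k' : S.E} (hL : 1 ≤ L)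
    (hA : S.IsConnectedSet (S.explored A U C)) (he : e ∈ S.explored A U C)
    (hf : f ∈ S.explored A U C) (hef : (L : ℝ) ≤ S.dE e f) (hpe : S.dE p e ≤ L + 1)
    (hK : S.IsConnectedSet K) (hKp : K ⊆ S.cl (S.ball p (L + 1)))
    (hKd : Disjoint (S.explored A U C) (S.cl K)) (hk : k ∈ K) (hk' : k' ∈ K)
    (hkk' : (L : ℝ) ≤ S.dE k k') (hw : S.dE p w ≤ ((L / 2 : ℕ) : ℝ))
    (hU : S.ball w (5 * L) ⊆ U) : C ∈ S.sepEvent w L := by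
  have h2 : ((L / 2 : ℕ) : ℝ) + 1 ≤ L := by
    have : L / 2 + 1 ≤ L := by omega
    exact_mod_cast this
  have hL1 : (1 : ℝ) ≤ L := by exact_mod_cast hL
  rw [S.dE_comm] at hw
  obtain ⟨D, hD, hDc, hDe, heD, g, hg, heg⟩ :=
    hA.exists_piece he hf (Nat.cast_nonneg L) hef
  refine ⟨D, K, hDe.trans (S.cl_mono (S.ball_subset_ball ?_)),
    hKp.trans (S.cl_mono (S.ball_subset_ball ?_)), hDc, hK, ⟨e, heD, g, hg, heg⟩,
    ⟨k, hk, k', hk', hkk'⟩, separates_of_disjoint_explored hU hD hKd⟩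
  · linarith [S.dE_triangle w p e]
  · linarith

theorem exists_center {x q : S.E} {M L : ℕ} (hL : 1 ≤ L) (hM : 100 * L ≤ M) {C : Set S.E}
    (hC : C ∈ S.sepEvent x M) : ∃ p, S.dE x p ≤ 3 * M + 1 ∧ (M : ℝ) / 50 < S.dE q p ∧
      ∀ w, S.dE p w ≤ ((L / 2 : ℕ) : ℝ) → C ∈ S.sepEvent w L := by
  obtain ⟨A₁, A₂, hA₁, hA₂, hc₁, hc₂, ⟨a, ha, a', ha', haa'⟩, ⟨b, hb, b', hb', hbb'⟩, hsep⟩ := hC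
  have hL1 : (1 : ℝ) ≤ L := by exact_mod_cast hL
  have hM1 : (100 : ℝ) * L ≤ M := by exact_mod_cast hM
  have h2 : ((L / 2 : ℕ) : ℝ) + 1 ≤ L := by
    have : L / 2 + 1 ≤ L := by omega
    exact_mod_cast this
  have far : ∀ (o c c' : S.E) (r : ℝ), (M : ℝ) ≤ S.dE c c' → 2 * r < M →
      r < S.dE o c ∨ r < S.dE o c' := by
    intro o c c' r h h'
    by_contra! hcon
    have := S.dE_triangle c o c'
    rw [S.dE_comm c o] at this
    linarith [hcon.1, hcon.2]
  set D : Set S.E := S.explored A₁ (S.ball x (5 * M)) C with hD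
  have hDc : S.IsConnectedSet D := hc₁.explored
  have hDfar : ∀ e ∈ D, ∃ f ∈ D, (L : ℝ) ≤ S.dE e f := fun e _ => by
    rcases far e a a' L haa' (by linarith) with h | h
    · exact ⟨a, subset_explored ha, h.le⟩
    · exact ⟨a', subset_explored ha', h.le⟩
  set R : ℕ := 3 * M + 1 with hR
  have hRr : (R : ℝ) = 3 * M + 1 := by rw [hR]; push_cast; ring
  set P : Set S.E := {p | S.dE x p ≤ R ∧ (M : ℝ) / 50 < S.dE q p} with hP
  obtain ⟨a₀, ha₀, ha₀P⟩ : ∃ a₀ ∈ A₁, a₀ ∈ P := by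
    rcases far q a a' (M / 50) haa' (by linarith) with h | h
    · exact ⟨a, ha, (S.cl_ball_subset _ _ (hA₁ ha)).trans_eq hRr.symm, h⟩
    · exact ⟨a', ha', (S.cl_ball_subset _ _ (hA₁ ha')).trans_eq hRr.symm, h⟩
  obtain ⟨b₀, hb₀, hb₀P⟩ : ∃ b₀ ∈ A₂, b₀ ∈ P := by
    rcases far q b b' (M / 50) hbb' (by linarith) with h | h
    · exact ⟨b, hb, (S.cl_ball_subset _ _ (hA₂ hb)).trans_eq hRr.symm, h⟩
    · exact ⟨b', hb', (S.cl_ball_subset _ _ (hA₂ hb')).trans_eq hRr.symm, h⟩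
  have conclude : ∀ p ∈ P, (∃ e ∈ D, S.dE p e ≤ L + 1) →
      (∃ K : Set S.E, S.IsConnectedSet K ∧ K ⊆ S.cl (S.ball p (L + 1)) ∧ Disjoint D (S.cl K) ∧
        ∃ k ∈ K, ∃ k' ∈ K, (L : ℝ) ≤ S.dE k k') →
      ∃ p, S.dE x p ≤ 3 * M + 1 ∧ (M : ℝ) / 50 < S.dE q p ∧
        ∀ w, S.dE p w ≤ ((L / 2 : ℕ) : ℝ) → C ∈ S.sepEvent w L := by
    rintro p ⟨hp, hp'⟩ ⟨e, he, hpe⟩ ⟨K, hK, hKp, hKD, k, hk, k', hk', hkk'⟩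
    obtain ⟨f, hf, hef⟩ := hDfar e he
    refine ⟨p, hp.trans_eq hRr, hp', fun w hw => ?_⟩
    refine S.mem_sepEvent_of_explored hL hDc he hf hef hpe hK hKp hKD hk hk' hkk' hw
      (S.ball_subset_ball ?_)
    linarith [S.dE_triangle x p w]
  choose Γ hΓmem hΓc hΓball hΓfar using fun p : S.E => S.exists_segment p L
  have hclΓ : ∀ p, S.cl (Γ p) ⊆ S.ball p (L + 1) := fun p =>
    (S.cl_mono (hΓball p)).trans (S.cl_ball_subset p L)
  by_cases hend : Disjoint D (S.cl (Γ b₀))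
  · have step : ∀ p, Relation.ReflTransGen (S.Link P) a₀ p → Disjoint D (S.cl (Γ p)) →
        ∃ u v, S.Link P u v ∧ ¬ Disjoint D (S.cl (Γ u)) ∧ Disjoint D (S.cl (Γ v)) := by
      intro p hp
      induction hp with
      | refl =>
        intro h
        exact absurd (Or.inl (hΓmem a₀)) (Set.disjoint_left.1 h (subset_explored ha₀))
      | @tail u v _ huv ih =>
        intro hv
        by_cases hu : Disjoint D (S.cl (Γ u))
        · exact ih hu
        · exact ⟨u, v, huv, hu, hv⟩
    obtain ⟨u, v, ⟨huv, huP, -⟩, hu, hv⟩ := step b₀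
      (S.link_avoiding (by rw [hRr]; linarith) ha₀P hb₀P) hend
    obtain ⟨e, he, heΓ⟩ := Set.not_disjoint_iff.1 hu
    obtain ⟨k', hk', hkk'⟩ := hΓfar v
    refine conclude u huP ⟨e, he, hclΓ u heΓ⟩
      ⟨Γ v, hΓc v, fun t ht => Or.inl ?_, hv, v, hΓmem v, k', hk', hkk'⟩
    exact S.ball_subset_ball (by linarith [S.dE_le_one_of_adjE huv]) (hΓball v ht)
  · obtain ⟨e, he, heΓ⟩ := Set.not_disjoint_iff.1 hend
    obtain ⟨b₁, hb₁, hbb₁⟩ : ∃ b₁ ∈ A₂, (L : ℝ) ≤ S.dE b₀ b₁ := by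
      rcases far b₀ b b' L hbb' (by linarith) with h | h
      · exact ⟨b, hb, h.le⟩
      · exact ⟨b', hb', h.le⟩
    obtain ⟨K, hK, hKc, hKb, hbK, k', hk', hkk'⟩ :=
      hc₂.exists_piece hb₀ hb₁ (Nat.cast_nonneg L) hbb₁
    refine conclude b₀ hb₀P ⟨e, he, hclΓ b₀ heΓ⟩ ⟨K, hKc,
      hKb.trans (S.cl_mono (S.ball_subset_ball ?_)),
      hsep.disjoint_explored.mono_right (S.cl_mono hK), b₀, hbK, k', hk', hkk'⟩
    rw [S.dE_self]
    linarith

theorem cA'_pos : 0 < S.cA' := by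
  obtain ⟨y⟩ : Nonempty S.V := have := S.infV; inferInstance
  have h := (S.ahlfors_lb y 1 (by norm_num)).trans (S.ahlfors_ub y 1 (by norm_num))
  rw [Real.one_rpow, mul_one, mul_one] at h
  exact S.cA_pos.trans_le h

/-- Balls of `G` are covered by a controlled number of smaller balls. -/
theorem exists_netG (y : S.V) {R m : ℕ} : ∃ N : Finset S.V, (∀ w ∈ N, S.dG y w ≤ R) ∧
    (∀ u, S.dG y u ≤ R → ∃ w ∈ N, S.dG u w ≤ m) ∧
    (N.card : ℝ) * (S.cA * (((m / 2 : ℕ) : ℝ) + 1 / 2) ^ S.α) ≤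
      S.cA' * ((R : ℝ) + (((m / 2 : ℕ) : ℝ) + 1 / 2)) ^ S.α := by
  set B : Finset S.V := (S.ballG_fin y R).toFinset with hB
  have hmemB : ∀ u, u ∈ B ↔ S.dG y u ≤ R := fun u => by simp [hB]
  set F : Finset (Finset S.V) :=
    B.powerset.filter (fun N => ∀ u ∈ N, ∀ v ∈ N, u ≠ v → m < S.dG u v) with hF
  obtain ⟨N, hN, hmax⟩ := F.exists_max_image Finset.card ⟨∅, by simp [hF]⟩
  rw [hF, Finset.mem_filter, Finset.mem_powerset] at hN
  obtain ⟨hNB, hNsep⟩ := hN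
  set s : ℝ := ((m / 2 : ℕ) : ℝ) + 1 / 2 with hs
  have hs2 : 1 / 2 ≤ s := by rw [hs]; linarith [Nat.cast_nonneg (α := ℝ) (m / 2)]
  have hle : ∀ n : ℕ, (n : ℝ) ≤ s → n ≤ m / 2 := fun n hn => by
    have : (n : ℝ) < ((m / 2 : ℕ) : ℝ) + 1 := by linarith
    have : n < m / 2 + 1 := by exact_mod_cast this
    omega
  refine ⟨N, fun w hw => (hmemB w).1 (hNB hw), fun u hu => ?_, ?_⟩
  · by_contra! hcon
    have huN : u ∉ N := fun h => by
      have := hcon u h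
      rw [S.dG_self] at this
      omega
    have := hmax (insert u N) (by
      rw [hF, Finset.mem_filter, Finset.mem_powerset]
      refine ⟨Finset.insert_subset ((hmemB u).2 hu) hNB, fun v hv w hw hvw => ?_⟩
      rw [Finset.mem_insert] at hv hw
      rcases hv with rfl | hv <;> rcases hw with rfl | hw
      · exact absurd rfl hvw
      · exact hcon w hw
      · rw [S.dG_comm]
        exact hcon v hv
      · exact hNsep v hv w hw hvw)
    rw [Finset.card_insert_of_notMem huN] at this
    omega
  · have hdisj : (N : Set S.V).PairwiseDisjoint fun w => (S.ballG_fin w s).toFinset := by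
      intro v hv w hw hvw
      refine Finset.disjoint_left.2 fun t ht ht' => ?_
      simp only [Set.Finite.mem_toFinset, Set.mem_ofPred_eq] at ht ht'
      have h1 := hNsep v hv w hw hvw
      have h2 := S.dG_triangle v t w
      have h3 := hle _ ht
      have h4 := hle _ ht'
      rw [S.dG_comm t w] at h2
      omega
    calc (N.card : ℝ) * (S.cA * s ^ S.α)
        ≤ ∑ w ∈ N, ∑ y' ∈ (S.ballG_fin w s).toFinset, ∑' y'', S.ρG y' y'' := by
          rw [← nsmul_eq_mul]
          exact Finset.card_nsmul_le_sum _ _ _ fun w _ => S.ahlfors_lb w s hs2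
      _ = ∑ y' ∈ N.biUnion fun w => (S.ballG_fin w s).toFinset, ∑' y'', S.ρG y' y'' :=
          (Finset.sum_biUnion hdisj).symm
      _ ≤ ∑ y' ∈ (S.ballG_fin y (R + s)).toFinset, ∑' y'', S.ρG y' y'' := by
          refine Finset.sum_le_sum_of_subset_of_nonneg (fun t ht => ?_)
            fun t _ _ => tsum_nonneg fun _ => S.ρG_nonneg _ _
          simp only [Finset.mem_biUnion, Set.Finite.mem_toFinset, Set.mem_ofPred_eq] at ht ⊢
          obtain ⟨w, hw, hwt⟩ := ht
          have h1 : (S.dG y w : ℝ) ≤ R := by exact_mod_cast (hmemB w).1 (hNB hw)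
          have h2 : (S.dG y t : ℝ) ≤ S.dG y w + S.dG w t := by exact_mod_cast S.dG_triangle y w t
          linarith
      _ ≤ S.cA' * ((R : ℝ) + s) ^ S.α :=
          S.ahlfors_ub _ _ (by linarith [Nat.cast_nonneg (α := ℝ) R])

/-- Vertical intervals are covered by a controlled number of shorter intervals. -/
theorem exists_netZ (z : ℤ) {R m : ℝ} (hR : 0 ≤ R) (hm : 0 ≤ m) : ∃ N : Finset ℤ,
    (∀ w ∈ N, S.dZ z w ≤ R + m) ∧ (∀ u, S.dZ z u ≤ R → ∃ w ∈ N, S.dZ u w ≤ m) ∧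
    (N.card : ℝ) ≤ 2 * (R ^ (S.β / 2) / (⌊m ^ (S.β / 2)⌋₊ + 1)) + 3 := by
  set k : ℕ := ⌊m ^ (S.β / 2)⌋₊ + 1 with hk
  set T : ℝ := R ^ (S.β / 2) / k with hT
  have hT0 : 0 ≤ T := by positivity
  have hk0 : (0 : ℤ) < k := by omega
  set J : ℤ := ⌊T⌋ + 1 with hJ
  refine ⟨((Finset.Icc (-J) J).image fun j => z + j * k).filter fun w => S.dZ z w ≤ R + m,
    fun w hw => (Finset.mem_filter.1 hw).2, fun u hu => ?_, ?_⟩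
  · have hmod0 := Int.emod_nonneg (u - z) hk0.ne'
    have hmod1 := Int.emod_lt_of_pos (u - z) hk0
    have hdiv := Int.emod_add_mul_ediv (u - z) k
    set j := (u - z) / k with hj
    set r := (u - z) % k with hr
    have hclose : S.dZ u (z + j * k) ≤ m := by
      rw [S.dZ_le_iff hm]
      have h1 : (u : ℝ) - ((z + j * k : ℤ) : ℝ) = (r : ℝ) := by
        have : u - (z + j * k) = r := by linarith
        exact_mod_cast this
      have h2 : (r : ℝ) ≤ (⌊m ^ (S.β / 2)⌋₊ : ℝ) := by
        have : r ≤ (⌊m ^ (S.β / 2)⌋₊ : ℤ) := by omega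
        exact_mod_cast this
      rw [h1, abs_of_nonneg (by exact_mod_cast hmod0)]
      exact h2.trans (Nat.floor_le (by positivity))
    refine ⟨z + j * k, Finset.mem_filter.2 ⟨Finset.mem_image.2 ⟨j, ?_, rfl⟩, ?_⟩, hclose⟩
    · rw [S.dZ_comm, S.dZ_le_iff hR] at hu
      have hkr : (0 : ℝ) < k := by exact_mod_cast hk0
      have hTk : R ^ (S.β / 2) = T * k := by rw [hT]; field_simp
      rw [hTk, abs_le] at hu
      have hfl := Int.lt_floor_add_one T
      have h3 : ((r : ℝ) + k * j) = u - z := by exact_mod_cast hdiv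
      have h4 : (0 : ℝ) ≤ r := by exact_mod_cast hmod0
      have h5 : (r : ℝ) < k := by exact_mod_cast hmod1
      rw [Finset.mem_Icc]
      constructor
      · have : (k : ℝ) * (-T - 1) < k * j := by nlinarith [hu.1]
        have := lt_of_mul_lt_mul_left this hkr.le
        have h6 : ((-J - 1 : ℤ) : ℝ) < j := by push_cast [hJ]; linarith
        have : -J - 1 < j := by exact_mod_cast h6
        omega
      · have : (k : ℝ) * j ≤ k * T := by nlinarith [hu.2]
        have := le_of_mul_le_mul_left this hkr
        have h6 : (j : ℝ) < (J : ℝ) := by push_cast [hJ]; linarith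
        exact_mod_cast h6.le
    · linarith [S.dZ_triangle z u (z + j * k)]
  · have hJ0 : 0 ≤ J := by have := Int.floor_nonneg.2 hT0; omega
    have h1 : (((Finset.Icc (-J) J).image fun j => z + j * k).filter
        fun w => S.dZ z w ≤ R + m).card ≤ (2 * J + 1).toNat :=
      (Finset.card_filter_le _ _).trans (Finset.card_image_le.trans (by
        rw [Int.card_Icc]
        omega))
    have h2 : (((2 * J + 1).toNat : ℤ) : ℝ) = 2 * J + 1 := by
      rw [Int.toNat_of_nonneg (by omega)]
      push_cast
      ring
    have h3 : (J : ℝ) ≤ T + 1 := by push_cast [hJ]; linarith [Int.floor_le T]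
    have h4 : (⌊m ^ (S.β / 2)⌋₊ : ℝ) + 1 = k := by rw [hk]; push_cast; rfl
    rw [h4, ← hT]
    calc _ ≤ (((2 * J + 1).toNat : ℕ) : ℝ) := by exact_mod_cast h1
      _ = 2 * J + 1 := by exact_mod_cast h2
      _ ≤ 2 * T + 3 := by linarith

/-- The ball `B(x, 3M + 1)` with `M = ℓL` is covered by order `ℓ ^ (α + β/2)` balls at scale `L`. -/
theorem exists_net (x : S.E) {ℓ L : ℕ} (hL : 1 ≤ L) (hℓ : 1 ≤ ℓ) : ∃ Λ : Finset S.E,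
    (Λ : Set S.E) ⊆ S.ball x (9 * ℓ * L) ∧
    (Λ.card : ℝ) ≤ S.cA' / S.cA * 40 ^ S.α * (2 * 16 ^ (S.β / 2) + 3) * ℓ ^ (S.α + S.β / 2) ∧
    ∀ p, S.dE x p ≤ 3 * ((ℓ * L : ℕ) : ℝ) + 1 → ∃ w ∈ Λ, S.dE p w ≤ ((L / 2 : ℕ) : ℝ) := by
  have hL1 : (1 : ℝ) ≤ L := by exact_mod_cast hL
  have hℓ1 : (1 : ℝ) ≤ ℓ := by exact_mod_cast hℓ
  have hα := S.α_gt_one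
  have hβ := S.β_ge_two
  have hLM : (L : ℝ) ≤ ℓ * L := le_mul_of_one_le_left (by linarith) hℓ1
  have hm1 : ((L / 2 : ℕ) : ℝ) ≤ L := by exact_mod_cast Nat.div_le_self L 2
  have hR : (((3 * (ℓ * L) + 1 : ℕ)) : ℝ) = 3 * (ℓ * L) + 1 := by push_cast; ring
  obtain ⟨N, hN1, hN2, hN3⟩ := S.exists_netG x.1 (R := 3 * (ℓ * L) + 1) (m := L / 2)
  obtain ⟨Z, hZ1, hZ2, hZ3⟩ := S.exists_netZ x.2 (R := 3 * (ℓ * L) + 1) (m := ((L / 2 : ℕ) : ℝ))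
    (by positivity) (by positivity)
  have hNcard : (N.card : ℝ) ≤ S.cA' / S.cA * 40 ^ S.α * ℓ ^ S.α := by
    have hs : (L : ℝ) / 8 ≤ ((L / 2 / 2 : ℕ) : ℝ) + 1 / 2 := by
      have : (L : ℝ) ≤ ((4 * (L / 2 / 2) + 3 : ℕ) : ℝ) := by
        exact_mod_cast (by omega : L ≤ 4 * (L / 2 / 2) + 3)
      push_cast at this
      linarith [Nat.cast_nonneg (α := ℝ) (L / 2 / 2)]
    have hs' : ((L / 2 / 2 : ℕ) : ℝ) + 1 / 2 ≤ L := by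
      have : ((2 * (L / 2 / 2) + 1 : ℕ) : ℝ) ≤ ((2 * L : ℕ) : ℝ) := by
        exact_mod_cast (by omega : 2 * (L / 2 / 2) + 1 ≤ 2 * L)
      push_cast at this
      linarith
    have h1 : (N.card : ℝ) * (S.cA * ((L : ℝ) / 8) ^ S.α) ≤
        S.cA' * (40 * ℓ * (L / 8)) ^ S.α := by
      refine (mul_le_mul_of_nonneg_left ?_ (Nat.cast_nonneg _)).trans
        (hN3.trans (mul_le_mul_of_nonneg_left ?_ S.cA'_pos.le))
      · exact mul_le_mul_of_nonneg_left (Real.rpow_le_rpow (by positivity) hs (by linarith))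
          S.cA_pos.le
      · rw [hR]
        exact Real.rpow_le_rpow (by positivity) (by linarith) (by linarith)
    rw [Real.mul_rpow (by positivity) (by positivity), Real.mul_rpow (by positivity) (by positivity)]
      at h1
    have h2 : 0 < ((L : ℝ) / 8) ^ S.α := by positivity
    have h3 : (N.card : ℝ) * S.cA ≤ S.cA' * (40 ^ S.α * ℓ ^ S.α) :=
      le_of_mul_le_mul_right (by linarith) h2
    calc (N.card : ℝ) ≤ S.cA' * (40 ^ S.α * ℓ ^ S.α) / S.cA := (le_div_iff₀ S.cA_pos).2 h3
      _ = _ := by ring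
  have hZcard : (Z.card : ℝ) ≤ (2 * 16 ^ (S.β / 2) + 3) * ℓ ^ (S.β / 2) := by
    have hk : ((L : ℝ) / 4) ^ (S.β / 2) ≤ (⌊((L / 2 : ℕ) : ℝ) ^ (S.β / 2)⌋₊ : ℝ) + 1 := by
      rcases Nat.lt_or_ge L 4 with h | h
      · have h1 : (L : ℝ) / 4 ≤ 1 := by
          have : (L : ℝ) < 4 := by exact_mod_cast h
          linarith
        have := Real.rpow_le_one (by positivity) h1 (by linarith : 0 ≤ S.β / 2)
        linarith [Nat.cast_nonneg (α := ℝ) ⌊((L / 2 : ℕ) : ℝ) ^ (S.β / 2)⌋₊]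
      · have h1 : (L : ℝ) ≤ ((4 * (L / 2) : ℕ) : ℝ) := by
          exact_mod_cast (by omega : L ≤ 4 * (L / 2))
        push_cast at h1
        refine (Real.rpow_le_rpow (by positivity) ?_ (by linarith)).trans
          (Nat.lt_floor_add_one _).le
        linarith
    have h1 : ((3 : ℝ) * (ℓ * L) + 1) ^ (S.β / 2) ≤ (16 * ℓ * (L / 4)) ^ (S.β / 2) :=
      Real.rpow_le_rpow (by positivity) (by linarith) (by linarith)
    rw [Real.mul_rpow (by positivity) (by positivity), Real.mul_rpow (by positivity) (by positivity)]
      at h1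
    have h2 : ((3 : ℝ) * (ℓ * L) + 1) ^ (S.β / 2) / (⌊((L / 2 : ℕ) : ℝ) ^ (S.β / 2)⌋₊ + 1) ≤
        16 ^ (S.β / 2) * ℓ ^ (S.β / 2) := by
      rw [div_le_iff₀ (by positivity)]
      exact h1.trans (mul_le_mul_of_nonneg_left hk (by positivity))
    have h3 : (1 : ℝ) ≤ (ℓ : ℝ) ^ (S.β / 2) := Real.one_le_rpow hℓ1 (by linarith)
    linarith
  refine ⟨N ×ˢ Z, fun w hw => ?_, ?_, fun p hp => ?_⟩
  · obtain ⟨h1, h2⟩ := Finset.mem_product.1 (Finset.mem_coe.1 hw)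
    have h3 : (S.dG x.1 w.1 : ℝ) ≤ ((3 * (ℓ * L) + 1 : ℕ) : ℝ) := by exact_mod_cast hN1 _ h1
    rw [hR] at h3
    exact S.dE_le_iff.2 ⟨by linarith, by linarith [hZ1 _ h2]⟩
  · rw [Finset.card_product, Nat.cast_mul, Real.rpow_add (by linarith)]
    calc (N.card : ℝ) * Z.card
        ≤ (S.cA' / S.cA * 40 ^ S.α * ℓ ^ S.α) * ((2 * 16 ^ (S.β / 2) + 3) * ℓ ^ (S.β / 2)) :=
          mul_le_mul hNcard hZcard (Nat.cast_nonneg _) ((Nat.cast_nonneg _).trans hNcard)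
      _ = _ := by ring
  · push_cast at hp
    obtain ⟨h1, h2⟩ := S.dE_le_iff.1 hp
    obtain ⟨w, hw, hw'⟩ := hN2 p.1 (by
      rw [← hR] at h1
      exact_mod_cast h1)
    obtain ⟨z, hz, hz'⟩ := hZ2 p.2 h2
    exact ⟨(w, z), Finset.mem_product.2 ⟨hw, hz⟩,
      S.dE_le_iff.2 ⟨by exact_mod_cast hw', hz'⟩⟩

theorem increasingEvent_sepEvent (x : S.E) (L : ℕ) : S.IncreasingEvent (S.sepEvent x L) := by
  rintro C C' hCC' ⟨A₁, A₂, h1, h2, h3, h4, h5, h6, h7, h8⟩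
  refine ⟨A₁, A₂, h1, h2, h3, h4, h5, h6, h7, fun n p hp hp' h0 hn => ?_⟩
  obtain ⟨i, hi, hiC⟩ := h8 n p hp hp' h0 hn
  exact ⟨i, hi, hCC' hiC⟩

theorem dependsOn_sepEvent (x : S.E) (L : ℕ) :
    S.DependsOn (S.sepEvent x L) (S.ball x (10 * L)) := by
  have key : ∀ C C' : Set S.E, C ∩ S.ball x (10 * L) = C' ∩ S.ball x (10 * L) →
      C ∈ S.sepEvent x L → C' ∈ S.sepEvent x L := by
    rintro C C' hCC' ⟨A₁, A₂, h1, h2, h3, h4, h5, h6, h7, h8⟩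
    refine ⟨A₁, A₂, h1, h2, h3, h4, h5, h6, h7, fun n p hp hp' h0 hn => ?_⟩
    obtain ⟨i, hi, hiC⟩ := h8 n p hp hp' h0 hn
    have hball : p i ∈ S.ball x (10 * L) := S.ball_subset_ball (by
      rw [S.dE_self]
      linarith [Nat.cast_nonneg (α := ℝ) L]) (hp i hi)
    exact ⟨i, hi, (hCC'.subset ⟨hiC, hball⟩).1⟩
  exact fun C C' h => ⟨key C C' h, key C' C h.symm⟩

theorem sepEvent_cascades : ∃ c : ℝ, 0 < c ∧
    S.CascadesLe (fun x L => S.sepEvent x L) (S.α + S.β / 2) c := by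
  have h1 := S.cA_pos
  have h2 := S.cA'_pos
  refine ⟨S.cA' / S.cA * 40 ^ S.α * (2 * 16 ^ (S.β / 2) + 3), by positivity,
    fun x L _ => S.dependsOn_sepEvent x L, fun ℓ x L hL hℓ hdvd => ?_⟩
  obtain ⟨Λ, hΛ, hcard, hnet⟩ := S.exists_net x hL hℓ
  refine ⟨Λ, hΛ, hcard, fun C hC => ?_⟩
  have hM : 100 * L ≤ ℓ * L := Nat.mul_le_mul_right L (Nat.le_of_dvd hℓ hdvd)
  have hM' : (100 : ℝ) * L ≤ ((ℓ * L : ℕ) : ℝ) := by exact_mod_cast hM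
  have hm : ((L / 2 : ℕ) : ℝ) ≤ L := by exact_mod_cast Nat.div_le_self L 2
  have find : ∀ q : S.E, ∃ w ∈ Λ, ((ℓ * L : ℕ) : ℝ) / 100 ≤ S.dE q w ∧ C ∈ S.sepEvent w L := by
    intro q
    obtain ⟨p, hp, hqp, hsep⟩ := S.exists_center (q := q) hL hM hC
    obtain ⟨w, hw, hpw⟩ := hnet p hp
    refine ⟨w, hw, ?_, hsep w hpw⟩
    have := S.dE_triangle q w p
    rw [S.dE_comm w p] at this
    linarith
  obtain ⟨w, hw, -, hCw⟩ := find x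
  obtain ⟨w', hw', hd, hCw'⟩ := find w
  simp only [Set.mem_iUnion]
  exact ⟨w, hw, w', hw', hd, hCw, hCw'⟩

end GraphSetup

/-- Proposition A.2: the family `𝒮 = (S_{x,L})` of separation events is a family of
increasing events on `{0,1}^E` that cascades with complexity at most `α + β/2`. -/
theorem stmt19 (S : GraphSetup) (W : WalkLaw S) (cg cg' : ℝ) (hG : W.GreenBounds cg cg') :
    (∀ (x : S.E) (L : ℕ), S.IncreasingEvent (S.sepEvent x L)) ∧
    ∃ c : ℝ, 0 < c ∧ S.CascadesLe (fun x L => S.sepEvent x L) (S.α + S.β / 2) c := by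
  exact ⟨S.increasingEvent_sepEvent, S.sepEvent_cascades⟩
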